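/- Let a, b ≥ 2 be integers that are not both powers of a common integer (equivalently, log a and log b are linearly independent over ℚ). If F ⊆ ℝ/ℤ is a closed subset invariant under both x ↦ a·x (mod 1) and x ↦ b·x (mod 1), then F is finite or F = ℝ/ℤ. -/

import Mathlib

open Filter Topology
open scoped Pointwise

/-- If `β > 0` and `α / β` is irrational, then `ℕα + ℕβ` meets `[y, y + δ]`
for all large `y`. -/
theorem exists_nat_combination_mem_Icc {α β : ℝ} (hβ : 0 < β)
    (h : Irrational (α / β)) {δ : ℝ} (hδ : 0 < δ) :
    ∃ Y : ℝ, ∀ y, Y ≤ y → ∃ m n : ℕ, y ≤ m * α + n * β ∧ m * α + n * β ≤ y + δ := by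
  obtain ⟨γ, hγ, hγ0, hγδ⟩ :=
    (dense_addSubgroupClosure_pair_iff.2 h).exists_between hδ
  obtain ⟨p, q, hpq⟩ := AddSubgroup.mem_closure_pair.1 hγ
  simp only [zsmul_eq_mul] at hpq
  obtain ⟨K, hK⟩ := exists_nat_ge (β / γ)
  rw [div_le_iff₀ hγ0] at hK
  refine ⟨K * (p.natAbs * α + q.natAbs * β), fun y hy => ?_⟩
  set s : ℝ := K * (p.natAbs * α + q.natAbs * β) with hs
  set n := ⌊(y - s) / β⌋₊
  have hn1 : n * β ≤ y - s := by
    rw [← le_div_iff₀ hβ]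
    exact Nat.floor_le (div_nonneg (by linarith) hβ.le)
  have hn2 : y - s < (n + 1) * β := by
    rw [← div_lt_iff₀ hβ]
    exact Nat.lt_floor_add_one _
  set j := ⌈(y - s - n * β) / γ⌉₊ with hj
  have hj1 : y - s - n * β ≤ j * γ := by
    rw [← div_le_iff₀ hγ0]
    exact Nat.le_ceil _
  have hj2 : j * γ ≤ y - s - n * β + γ := by
    have := Nat.ceil_lt_add_one (div_nonneg (by linarith : 0 ≤ y - s - n * β) hγ0.le)
    rw [← hj, ← sub_lt_iff_lt_add, lt_div_iff₀ hγ0] at this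
    linarith
  have hjK : j ≤ K := by
    refine Nat.ceil_le.2 ?_
    rw [div_le_iff₀ hγ0]
    linarith
  have key : ∀ z : ℤ, 0 ≤ (K * z.natAbs + j * z : ℤ) := fun z => by
    have h1 : -(z.natAbs : ℤ) ≤ z := by lia
    have h2 : (j : ℤ) * z.natAbs ≤ K * z.natAbs := by gcongr
    nlinarith
  have hcast : ∀ z : ℤ, ((K * z.natAbs + j * z : ℤ).toNat : ℝ) = K * z.natAbs + j * z := fun z => by
    have := congrArg (Int.cast : ℤ → ℝ) (Int.toNat_of_nonneg (key z))
    push_cast [-Int.natCast_natAbs] at this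
    exact this
  have hsum : ((K * p.natAbs + j * p : ℤ).toNat : ℝ) * α
      + ((n + (K * q.natAbs + j * q : ℤ).toNat : ℕ) : ℝ) * β = s + n * β + j * γ := by
    rw [Nat.cast_add, hcast, hcast, ← hpq, hs]
    ring
  refine ⟨_, _, hsum.ge.trans' ?_, hsum.le.trans ?_⟩ <;> linarith

/-- The semigroup `{a ^ m * b ^ n}` meets `[y, (1 + ε) y]` for all large `y`. -/
theorem exists_pow_mul_pow_mem_Icc {a b : ℕ} (ha : 2 ≤ a) (hb : 2 ≤ b)
    (hab : Irrational (Real.log a / Real.log b)) {ε : ℝ} (hε : 0 < ε) :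
    ∃ N : ℝ, 0 < N ∧ ∀ y, N ≤ y → ∃ m n : ℕ,
      y ≤ (a ^ m * b ^ n : ℕ) ∧ ((a ^ m * b ^ n : ℕ) : ℝ) ≤ (1 + ε) * y := by
  obtain ⟨Y, hY⟩ := exists_nat_combination_mem_Icc
    (Real.log_pos (by exact_mod_cast hb : (1 : ℝ) < b)) hab
    (Real.log_pos (by linarith : 1 < 1 + ε))
  refine ⟨Real.exp Y, Real.exp_pos _, fun y hy => ?_⟩
  have hy0 : 0 < y := (Real.exp_pos _).trans_le hy
  obtain ⟨m, n, h1, h2⟩ := hY (Real.log y) ((Real.le_log_iff_exp_le hy0).2 hy)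
  have ha0 : (0 : ℝ) < a := by positivity
  have hb0 : (0 : ℝ) < b := by positivity
  have hlog : Real.log ((a ^ m * b ^ n : ℕ) : ℝ) = m * Real.log a + n * Real.log b := by
    push_cast
    rw [Real.log_mul (by positivity) (by positivity), Real.log_pow, Real.log_pow]
  have hpos : (0 : ℝ) < (a ^ m * b ^ n : ℕ) := by positivity
  rw [← hlog] at h1 h2
  refine ⟨m, n, (Real.log_le_log_iff hy0 hpos).1 h1, ?_⟩
  rw [add_comm, ← Real.log_mul (by positivity) hy0.ne'] at h2
  exact (Real.log_le_log_iff hpos (by positivity)).1 h2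

theorem UnitAddCircle.norm_coe_le (x : ℝ) : ‖(x : UnitAddCircle)‖ ≤ |x| := by
  simpa [UnitAddCircle.norm_eq] using round_le x 0

theorem UnitAddCircle.exists_coe_eq_abs_eq_norm (x : UnitAddCircle) :
    ∃ r : ℝ, (r : UnitAddCircle) = x ∧ |r| = ‖x‖ := by
  obtain ⟨r, rfl⟩ := QuotientAddGroup.mk_surjective x
  refine ⟨r - round r, ?_, (UnitAddCircle.norm_eq).symm⟩
  have : ((round r : ℝ) : UnitAddCircle) = 0 := (AddCircle.coe_eq_zero_iff 1).2 ⟨round r, by simp⟩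
  rw [AddCircle.coe_sub, this, sub_zero]

theorem UnitAddCircle.exists_coe_eq_mem_Ico (x : UnitAddCircle) :
    ∃ r ∈ Set.Ico (1 : ℝ) 2, (r : UnitAddCircle) = x := by
  obtain ⟨r, hr, rfl⟩ := AddCircle.eq_coe_Ico x
  exact ⟨r + 1, ⟨by linarith [hr.1], by linarith [hr.2]⟩, AddCircle.coe_add_period 1 r⟩

theorem pow_mul_pow_nsmul_mem {M : Type*} [AddMonoid M] {a b : ℕ} {F : Set M}
    (hFa : ∀ x ∈ F, a • x ∈ F) (hFb : ∀ x ∈ F, b • x ∈ F) {x : M} (hx : x ∈ F) (m n : ℕ) :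
    (a ^ m * b ^ n) • x ∈ F := by
  have hpow : ∀ {c : ℕ}, (∀ x ∈ F, c • x ∈ F) → ∀ k, ∀ x ∈ F, (c ^ k) • x ∈ F := by
    intro c hc k
    induction k with
    | zero => simp
    | succ k ih =>
      intro x hx
      rw [pow_succ, mul_nsmul']
      exact ih _ (hc x hx)
  rw [mul_nsmul']
  exact hpow hFa m _ (hpow hFb n x hx)

/-- A closed invariant set accumulating at `0` is the whole circle. -/
theorem eq_univ_of_accPt_zero {a b : ℕ} (ha : 2 ≤ a) (hb : 2 ≤ b)
    (hab : Irrational (Real.log a / Real.log b)) {F : Set UnitAddCircle} (hF : IsClosed F)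
    (hFa : ∀ x ∈ F, a • x ∈ F) (hFb : ∀ x ∈ F, b • x ∈ F) (h0 : AccPt 0 (𝓟 F)) :
    F = Set.univ := by
  refine Set.eq_univ_of_forall fun z => hF.closure_eq ▸ Metric.mem_closure_iff.2 fun ε hε => ?_
  obtain ⟨N, hN, hS⟩ := exists_pow_mul_pow_mem_Icc ha hb hab (half_pos hε)
  obtain ⟨x, ⟨hxN, hxF⟩, hx0⟩ := accPt_iff_nhds.1 h0 _ (Metric.ball_mem_nhds 0 (inv_pos.2 hN))
  rw [mem_ball_zero_iff] at hxN
  obtain ⟨r, rfl, hr⟩ := UnitAddCircle.exists_coe_eq_abs_eq_norm x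
  rw [← hr] at hxN
  have hr0 : 0 < |r| := by rw [hr]; exact norm_pos_iff.2 hx0
  have key : ∀ w ∈ Set.Ico (1 : ℝ) 2, ∃ s : ℕ, s • (r : UnitAddCircle) ∈ F ∧
      abs (w - s * |r|) < ε := by
    intro w hw
    have hNw : N ≤ w / |r| := by
      rw [le_div_iff₀ hr0]
      have := (mul_lt_mul_iff_right₀ hN).2 hxN
      rw [mul_inv_cancel₀ hN.ne'] at this
      exact this.le.trans hw.1
    obtain ⟨m, n, h1, h2⟩ := hS _ hNw
    refine ⟨_, pow_mul_pow_nsmul_mem hFa hFb hxF m n, ?_⟩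
    rw [div_le_iff₀ hr0] at h1
    rw [← mul_div_assoc, le_div_iff₀ hr0] at h2
    rw [abs_lt]
    constructor <;> nlinarith [hw.1, hw.2]
  rcases abs_choice r with hrr | hrr
  · obtain ⟨w, hw, rfl⟩ := UnitAddCircle.exists_coe_eq_mem_Ico z
    obtain ⟨s, hsF, hs⟩ := key w hw
    refine ⟨_, hsF, ?_⟩
    rw [dist_eq_norm, ← AddCircle.coe_nsmul, ← AddCircle.coe_sub]
    refine (UnitAddCircle.norm_coe_le _).trans_lt ?_
    rwa [nsmul_eq_mul, ← hrr]
  · obtain ⟨w, hw, hwz⟩ := UnitAddCircle.exists_coe_eq_mem_Ico (-z)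
    obtain ⟨s, hsF, hs⟩ := key w hw
    refine ⟨_, hsF, ?_⟩
    rw [← dist_neg_neg, ← hwz, dist_eq_norm, ← AddCircle.coe_nsmul, ← AddCircle.coe_neg,
      ← AddCircle.coe_sub]
    refine (UnitAddCircle.norm_coe_le _).trans_lt ?_
    rwa [nsmul_eq_mul, ← mul_neg, ← hrr]

theorem log_pow_div_log_pow (a b : ℕ) {u : ℕ} (hu : 0 < u) :
    Real.log (a ^ u : ℕ) / Real.log (b ^ u : ℕ) = Real.log a / Real.log b := by
  push_cast
  rw [Real.log_pow, Real.log_pow, mul_div_mul_left _ _ (by positivity)]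

theorem exists_pow_nsmul_eq_self {G : Type*} [AddGroup G] {a b : ℕ} {x : G}
    (hx : IsOfFinAddOrder x) (hab : (a * b).Coprime (addOrderOf x)) :
    ∃ u, 0 < u ∧ (a ^ u) • x = x ∧ (b ^ u) • x = x := by
  have key : ∀ c : ℕ, c.Coprime (addOrderOf x) → (c ^ (addOrderOf x).totient) • x = x :=
    fun c hc => by
      conv_rhs => rw [← one_nsmul x]
      exact nsmul_eq_nsmul_iff_modEq.2 (Nat.ModEq.pow_totient hc)
  exact ⟨_, Nat.totient_pos.2 hx.addOrderOf_pos, key a (Nat.Coprime.coprime_mul_right hab),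
    key b (Nat.Coprime.coprime_mul_left hab)⟩

/-- Multiplying a torsion element by a suitable power of `c` makes its order coprime to `c`. -/
theorem IsOfFinAddOrder.exists_pow_nsmul_coprime {G : Type*} [AddGroup G] {x : G}
    (hx : IsOfFinAddOrder x) (c : ℕ) :
    ∃ i : ℕ, c.Coprime (addOrderOf ((c ^ i) • x)) := by
  have : NeZero (addOrderOf x) := ⟨hx.addOrderOf_pos.ne'⟩
  obtain ⟨i, j, hij, h⟩ := Finite.exists_ne_map_eq_of_infinite
    (fun i : ℕ => ((c ^ i : ℕ) : ZMod (addOrderOf x)))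
  wlog hlt : i < j generalizing i j
  · exact this j i hij.symm h.symm (by lia)
  have h' : (c ^ i) • x = (c ^ j) • x :=
    hx.nsmul_eq_nsmul_iff_modEq.2 ((ZMod.natCast_eq_natCast_iff _ _ _).1 h)
  refine ⟨i, ?_⟩
  obtain ⟨k, rfl⟩ := Nat.exists_eq_add_of_lt hlt
  have h1 : (c ^ (k + 1)) • ((c ^ i) • x) = 1 • ((c ^ i) • x) := by
    rw [one_nsmul, ← mul_nsmul, ← pow_add, ← add_assoc, ← h']
  have h2 := hx.nsmul.nsmul_eq_nsmul_iff_modEq.1 h1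
  refine Nat.Coprime.coprime_dvd_left (dvd_pow_self c k.succ_ne_zero) ?_
  rw [Nat.Coprime, h2.gcd_eq, Nat.gcd_one_left]

theorem AccPt.nsmul {a : ℕ} (ha : 0 < a) {F : Set UnitAddCircle}
    (hFa : ∀ x ∈ F, a • x ∈ F) {x : UnitAddCircle} (hx : AccPt x (𝓟 F)) :
    AccPt (a • x) (𝓟 F) := by
  rw [accPt_iff_frequently] at hx ⊢
  have hfin : ({u : UnitAddCircle | a • u = 0} \ {0}).Finite :=
    (AddCircle.finite_torsion (1 : ℝ) ha).subset Set.sdiff_subset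
  have hev : ∀ᶠ y in 𝓝 x, y - x ∉ {u : UnitAddCircle | a • u = 0} \ {0} := by
    have hcont : Tendsto (fun y => y - x) (𝓝 x) (𝓝 0) := by
      simpa using (continuous_sub_right x).tendsto x
    exact hcont.eventually (hfin.isClosed.isOpen_compl.mem_nhds (by simp))
  refine ((continuous_nsmul a).tendsto x).frequently ((hx.and_eventually hev).mono ?_)
  rintro y ⟨⟨hyx, hyF⟩, hy⟩
  refine ⟨fun h => hy ⟨?_, sub_ne_zero.2 hyx⟩, hFa y hyF⟩
  simp [nsmul_sub, h]

/-- A closed invariant set accumulating at a torsion point is the whole circle. -/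
theorem eq_univ_of_accPt_isOfFinAddOrder {a b : ℕ} (ha : 2 ≤ a) (hb : 2 ≤ b)
    (hab : Irrational (Real.log a / Real.log b)) {F : Set UnitAddCircle} (hF : IsClosed F)
    (hFa : ∀ x ∈ F, a • x ∈ F) (hFb : ∀ x ∈ F, b • x ∈ F) {x : UnitAddCircle}
    (hx : IsOfFinAddOrder x) (hxF : AccPt x (𝓟 F)) : F = Set.univ := by
  obtain ⟨i, hi⟩ := hx.exists_pow_nsmul_coprime (a * b)
  set r := ((a * b) ^ i) • x
  have hrF : AccPt r (𝓟 F) := hxF.nsmul (by positivity) fun y hy => by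
    rw [mul_pow]
    exact pow_mul_pow_nsmul_mem hFa hFb hy i i
  obtain ⟨u, hu, hau, hbu⟩ := exists_pow_nsmul_eq_self hx.nsmul hi
  have hpow : ∀ c : ℕ, 2 ≤ c → 2 ≤ c ^ u := fun c hc => hc.trans (Nat.le_self_pow hu.ne' c)
  have hG : (· + r) ⁻¹' F = Set.univ := by
    refine eq_univ_of_accPt_zero (hpow a ha) (hpow b hb)
      (by rwa [log_pow_div_log_pow a b hu]) (hF.preimage (continuous_add_const r))
      (fun y hy => ?_) (fun y hy => ?_) ?_
    · have := pow_mul_pow_nsmul_mem hFa hFb hy u 0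
      rwa [pow_zero, mul_one, nsmul_add, hau] at this
    · have := pow_mul_pow_nsmul_mem hFa hFb hy 0 u
      rwa [pow_zero, one_mul, nsmul_add, hbu] at this
    · rw [accPt_iff_frequently] at hrF ⊢
      have hcont : Tendsto (fun y => y - r) (𝓝 r) (𝓝 0) := by
        simpa using (continuous_sub_right r).tendsto r
      refine hcont.frequently (hrF.mono ?_)
      rintro y ⟨hyr, hy⟩
      exact ⟨sub_ne_zero.2 hyr, by simpa using hy⟩
  refine Set.eq_univ_of_forall fun z => ?_
  have : z - r ∈ (· + r) ⁻¹' F := hG ▸ Set.mem_univ _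
  simpa using this

theorem Set.Finite.exists_isOfFinAddOrder {G : Type*} [AddGroup G] {a : ℕ} (ha : 2 ≤ a)
    {B : Set G} (hB : B.Finite) (hne : B.Nonempty) (hBa : ∀ x ∈ B, a • x ∈ B) :
    ∃ x ∈ B, IsOfFinAddOrder x := by
  obtain ⟨x, hx⟩ := hne
  refine ⟨x, hx, ?_⟩
  by_contra hfin
  refine Set.infinite_of_injective_forall_mem (f := fun i : ℕ => (a ^ i) • x)
    ((injective_nsmul_iff_not_isOfFinAddOrder.2 hfin).comp (Nat.pow_right_injective ha))
    (fun i => ?_) hB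
  simpa using pow_mul_pow_nsmul_mem hBa hBa hx i 0

theorem Set.Infinite.accPt_zero_sub {G : Type*} [AddGroup G] [TopologicalSpace G]
    [ContinuousSub G] [CompactSpace G] [T1Space G] {B : Set G} (hB : B.Infinite) :
    AccPt 0 (𝓟 (B - B)) := by
  obtain ⟨x, hx⟩ := hB.exists_accPt_principal
  rw [accPt_iff_nhds]
  intro U hU
  have hcont : Tendsto (fun p : G × G => p.1 - p.2) (𝓝 x ×ˢ 𝓝 x) (𝓝 0) := by
    simpa [nhds_prod_eq] using (continuous_sub (G := G)).tendsto (x, x)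
  obtain ⟨V, hV, hVU⟩ := Filter.mem_prod_same_iff.1 (hcont hU)
  have hinf : (V ∩ B).Infinite := Set.Infinite.of_accPt (hx.nhds_inter hV)
  obtain ⟨p, hp, q, hq, hpq⟩ := hinf.nontrivial
  exact ⟨p - q, ⟨hVU (Set.mk_mem_prod hp.1 hq.1), Set.sub_mem_sub hp.2 hq.2⟩,
    sub_ne_zero.2 hpq⟩

/-- A nonempty closed invariant set contains a torsion point. -/
theorem exists_isOfFinAddOrder_mem {a b : ℕ} (ha : 2 ≤ a) (hb : 2 ≤ b)
    (hab : Irrational (Real.log a / Real.log b)) {E : Set UnitAddCircle} (hE : IsClosed E)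
    (hne : E.Nonempty) (hEa : ∀ x ∈ E, a • x ∈ E) (hEb : ∀ x ∈ E, b • x ∈ E) :
    ∃ x ∈ E, IsOfFinAddOrder x := by
  by_contra! htor
  have progression : ∀ y : UnitAddCircle, IsOfFinAddOrder y → (a * b).Coprime (addOrderOf y) →
      ∀ i : ℕ, ∃ x, ∀ j ≤ i, x + j • y ∈ E := by
    intro y hy hcop i
    obtain ⟨u, hu, hau, hbu⟩ := exists_pow_nsmul_eq_self hy hcop
    have hpow : ∀ c : ℕ, 2 ≤ c → 2 ≤ c ^ u := fun c hc => hc.trans (Nat.le_self_pow hu.ne' c)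
    suffices ∃ B : Set UnitAddCircle, IsClosed B ∧ B.Nonempty ∧ (∀ x ∈ B, (a ^ u) • x ∈ B) ∧
        (∀ x ∈ B, (b ^ u) • x ∈ B) ∧ ∀ x ∈ B, ∀ j ≤ i, x + j • y ∈ E by
      obtain ⟨B, -, ⟨x, hx⟩, -, -, h⟩ := this
      exact ⟨x, h x hx⟩
    induction i with
    | zero =>
      refine ⟨E, hE, hne, fun x hx => ?_, fun x hx => ?_, fun x hx j hj => ?_⟩
      · simpa using pow_mul_pow_nsmul_mem hEa hEb hx u 0
      · simpa using pow_mul_pow_nsmul_mem hEa hEb hx 0 u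
      · obtain rfl : j = 0 := by lia
        simpa using hx
    | succ i ih =>
      obtain ⟨B, hB, hBne, hBa, hBb, hBE⟩ := ih
      have hinf : B.Infinite := fun hfin => by
        obtain ⟨x, hx, hxt⟩ := hfin.exists_isOfFinAddOrder (hpow a ha) hBne hBa
        exact htor x (by simpa using hBE x hx 0 i.zero_le) hxt
      have hsub : ∀ c : ℕ, (∀ x ∈ B, c • x ∈ B) → ∀ x ∈ B - B, c • x ∈ B - B := by
        rintro c hc _ ⟨p, hp, q, hq, rfl⟩
        exact ⟨_, hc p hp, _, hc q hq, (nsmul_sub p q c).symm⟩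
      have hclosed : IsClosed (B - B) := by
        rw [← Set.image2_sub, ← Set.image_prod]
        exact ((hB.isCompact.prod hB.isCompact).image continuous_sub).isClosed
      have huniv : B - B = Set.univ := eq_univ_of_accPt_zero (hpow a ha) (hpow b hb)
        (by rwa [log_pow_div_log_pow a b hu])
        hclosed (hsub _ hBa) (hsub _ hBb) hinf.accPt_zero_sub
      obtain ⟨p, hp, q, hq, hpq⟩ : y ∈ B - B := huniv ▸ Set.mem_univ y
      refine ⟨B ∩ (· + y) ⁻¹' B, hB.inter (hB.preimage (continuous_add_const y)),
        ⟨q, hq, ?_⟩, fun x hx => ⟨hBa x hx.1, ?_⟩, fun x hx => ⟨hBb x hx.1, ?_⟩,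
        fun x hx j hj => ?_⟩
      · simpa [← hpq] using hp
      · have := hBa _ hx.2
        rwa [nsmul_add, hau] at this
      · have := hBb _ hx.2
        rwa [nsmul_add, hbu] at this
      · cases j with
        | zero => exact hBE x hx.1 0 i.zero_le
        | succ j =>
          have := hBE _ hx.2 j (by lia)
          rwa [add_assoc, ← succ_nsmul'] at this
  refine htor 0 ?_ IsOfFinAddOrder.zero
  rw [← hE.closure_eq, Metric.mem_closure_iff]
  intro ε hε
  obtain ⟨k, hk⟩ := exists_nat_gt ε⁻¹
  set t := a * b * k + 1 with ht
  have ht0 : (0 : ℝ) < t := by positivity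
  have hkt : k ≤ t := by
    have : 1 * k ≤ a * b * k := Nat.mul_le_mul_right k (by nlinarith)
    lia
  have htε : (t : ℝ)⁻¹ < ε :=
    inv_lt_of_inv_lt₀ hε (hk.trans_le (by exact_mod_cast hkt))
  have hord : addOrderOf (((1 : ℝ) / t : ℝ) : UnitAddCircle) = t :=
    AddCircle.addOrderOf_period_div (by lia)
  obtain ⟨x, hx⟩ := progression (((1 : ℝ) / t : ℝ) : UnitAddCircle)
    (addOrderOf_pos_iff.1 (by rw [hord]; lia)) (by rw [hord, ht]; simp) t
  obtain ⟨r, hr, hrx⟩ := AddCircle.eq_coe_Ico (-x)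
  have hrt : 0 ≤ r * t := mul_nonneg hr.1 ht0.le
  refine ⟨_, hx ⌊r * t⌋₊ (Nat.floor_le_of_le ?_), ?_⟩
  · nlinarith [hr.2]
  rw [eq_neg_of_add_eq_zero_left (neg_eq_iff_add_eq_zero.1 hrx.symm), dist_zero_left,
    ← AddCircle.coe_nsmul, ← AddCircle.coe_neg, ← AddCircle.coe_add]
  refine (UnitAddCircle.norm_coe_le _).trans_lt (htε.trans_le' ?_)
  have h1 := Nat.floor_le hrt
  have h2 := Nat.lt_floor_add_one (r * t)
  rw [nsmul_eq_mul, ← mul_le_mul_iff_left₀ ht0, inv_mul_cancel₀ ht0.ne', ← abs_of_pos ht0,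
    ← abs_mul, abs_of_pos ht0, add_mul, mul_assoc, one_div_mul_cancel ht0.ne', abs_le]
  constructor <;> linarith

/-- Furstenberg's theorem: a closed subset of the circle `ℝ/ℤ` invariant under
multiplication by `a` and by `b` (with `log a / log b` irrational) is finite or everything. -/
theorem statement0 (a b : ℕ) (ha : 2 ≤ a) (hb : 2 ≤ b)
    (hab : Irrational (Real.log a / Real.log b))
    (F : Set (AddCircle (1 : ℝ))) (hF : IsClosed F)
    (hFa : ∀ x ∈ F, a • x ∈ F) (hFb : ∀ x ∈ F, b • x ∈ F) :
    F.Finite ∨ F = Set.univ := by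
  refine or_iff_not_imp_left.2 fun hinf => ?_
  obtain ⟨x, hx, hxt⟩ := exists_isOfFinAddOrder_mem ha hb hab (isClosed_derivedSet F)
    (Set.Infinite.exists_accPt_principal hinf)
    (fun x hx => AccPt.nsmul (by lia) hFa hx) (fun x hx => AccPt.nsmul (by lia) hFb hx)
  exact eq_univ_of_accPt_isOfFinAddOrder ha hb hab hF hFa hFb hxt hx
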